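/- Let |A⟩, |B⟩, |C⟩ be unit vectors in ℂ² none of which is proportional to |0⟩ or |1⟩, and let |A^⊥⟩, |B^⊥⟩, |C^⊥⟩ be unit vectors orthogonal to them. Then the four vectors |S_1⟩ = |0⟩⊗|0⟩⊗|0⟩, |S_2⟩ = |1⟩⊗|B⟩⊗|C⟩, |S_3⟩ = |A⟩⊗|1⟩⊗|C^⊥⟩, |S_4⟩ = |A^⊥⟩⊗|B^⊥⟩⊗|1⟩ form a three-qubit unextendible product basis: they are mutually orthogonal product vectors whose span has an orthogonal complement containing no nonzero product vector. -/

import Mathlib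

noncomputable section

open Matrix Finset
open scoped ComplexOrder

/-- one-qubit vectors -/
abbrev V2 := Fin 2 → ℂ
/-- index set of the three-qubit space ℂ²⊗ℂ²⊗ℂ² -/
abbrev I8 := Fin 2 × Fin 2 × Fin 2
/-- three-qubit vectors -/
abbrev V8 := I8 → ℂ
/-- one-qubit operators -/
abbrev M2 := Matrix (Fin 2) (Fin 2) ℂ
/-- three-qubit operators -/
abbrev M8 := Matrix I8 I8 ℂ

/-- inner product on ℂ², conjugate-linear in the first argument -/
def inner2 (u v : V2) : ℂ := ∑ i, star (u i) * v i

/-- inner product on ℂ²⊗ℂ²⊗ℂ², conjugate-linear in the first argument -/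
def inner8 (u v : V8) : ℂ := ∑ p, star (u p) * v p

/-- tensor product |a⟩⊗|b⟩⊗|c⟩ of three one-qubit vectors -/
def tp3 (a b c : V2) : V8 := fun p => a p.1 * b p.2.1 * c p.2.2

/-- Kronecker (tensor) product X_A⊗X_B⊗X_C of three one-qubit operators -/
def kron3 (X Y Z : M2) : M8 :=
  Matrix.of fun p q => X p.1 q.1 * Y p.2.1 q.2.1 * Z p.2.2 q.2.2

/-- a product operator on three qubits -/
def IsProductOp (X : M8) : Prop := ∃ XA XB XC : M2, X = kron3 XA XB XC

/-- the projector |v⟩⟨v| onto a vector -/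
def proj8 (v : V8) : M8 := Matrix.vecMulVec v (star v)

/-- A three-qubit unextendible product basis with `n` members: mutually orthonormal
product vectors (products of unit vectors) such that the orthogonal complement of
their span contains no nonzero product vector. -/
structure UPB (n : ℕ) where
  S : Fin n → V8
  prod : ∀ j, ∃ a b c : V2,
    inner2 a a = 1 ∧ inner2 b b = 1 ∧ inner2 c c = 1 ∧ S j = tp3 a b c
  ortho : ∀ i j, inner8 (S i) (S j) = if i = j then 1 else 0
  unext : ∀ a b c : V2, (∀ j, inner8 (S j) (tp3 a b c) = 0) → tp3 a b c = 0

/-- the bound entangled state ρ_S = (1/(8-n))(I - Σ_j |S_j⟩⟨S_j|) associated with a UPB -/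
def upbState {n : ℕ} (U : UPB n) : M8 :=
  ((8 : ℂ) - (n : ℂ))⁻¹ • ((1 : M8) - ∑ j, proj8 (U.S j))

/-- equivalence of four-member UPBs: related by local unitaries and a permutation of members -/
def UPB.Equiv (S T : UPB 4) : Prop :=
  ∃ UA UB UC : M2, UA ∈ Matrix.unitaryGroup (Fin 2) ℂ ∧
    UB ∈ Matrix.unitaryGroup (Fin 2) ℂ ∧ UC ∈ Matrix.unitaryGroup (Fin 2) ℂ ∧
    ∃ σ : Equiv.Perm (Fin 4), ∀ j, S.S j = (kron3 UA UB UC).mulVec (T.S (σ j))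

/-- square root of a positive semidefinite matrix (junk value 0 otherwise) -/
def msqrt {m : Type*} [Fintype m] [DecidableEq m] (A : Matrix m m ℂ) : Matrix m m ℂ :=
  open scoped Classical in if h : A.PosSemidef then
    (h.1.eigenvectorUnitary : Matrix m m ℂ) *
      Matrix.diagonal ((fun x : ℝ => (x : ℂ)) ∘ Real.sqrt ∘ h.1.eigenvalues) *
      (star h.1.eigenvectorUnitary : Matrix m m ℂ) else 0

/-- fidelity F(ρ,σ) = tr √(√ρ σ √ρ) of positive semidefinite matrices -/
def fidelity {m : Type*} [Fintype m] [DecidableEq m] (ρ σ : Matrix m m ℂ) : ℝ :=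
  ((msqrt (msqrt ρ * σ * msqrt ρ)).trace).re

/-- standard basis vector |0⟩ of ℂ² -/
def e0 : V2 := ![1, 0]
/-- standard basis vector |1⟩ of ℂ² -/
def e1 : V2 := ![0, 1]

theorem inner2_apply (u v : V2) : inner2 u v = star (u 0) * v 0 + star (u 1) * v 1 := by
  simp [inner2]

theorem inner2_symm_zero {u v : V2} (h : inner2 u v = 0) : inner2 v u = 0 := by
  have := congrArg star h
  rw [inner2_apply] at this ⊢
  simp only [star_add, star_mul, star_star, star_zero] at this
  exact this

theorem inner8_tp3 (a b c a' b' c' : V2) :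
    inner8 (tp3 a b c) (tp3 a' b' c') = inner2 a a' * inner2 b b' * inner2 c c' := by
  simp only [inner8, inner2_apply, tp3, Fintype.sum_prod_type, Fin.sum_univ_two, star_mul]
  ring

/-- the four directions |0⟩, |1⟩, |A⟩, |A⊥⟩ of a single qubit -/
def frame (A Ap : V2) : Fin 4 → V2 := ![e0, e1, A, Ap]

/-- a vector orthogonal to any two different members of the family vanishes -/
def PairwiseSpanning {ι : Type*} (u : ι → V2) : Prop :=
  ∀ i j, i ≠ j → ∀ x, inner2 (u i) x = 0 → inner2 (u j) x = 0 → x = 0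

theorem PairwiseSpanning.comp {ι κ : Type*} {u : ι → V2} (h : PairwiseSpanning u) {f : κ → ι}
    (hf : Function.Injective f) : PairwiseSpanning (u ∘ f) :=
  fun i j hij => h (f i) (f j) (hf.ne hij)

theorem pairwiseSpanning_of_lt {ι : Type*} [LinearOrder ι] {u : ι → V2}
    (h : ∀ i j, i < j → ∀ x, inner2 (u i) x = 0 → inner2 (u j) x = 0 → x = 0) :
    PairwiseSpanning u := by
  intro i j hij x hi hj
  rcases lt_or_gt_of_ne hij with hlt | hlt
  · exact h i j hlt x hi hj
  · exact h j i hlt x hj hi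

theorem pairwiseSpanning_frame {A Ap : V2} (hA : inner2 A A = 1) (hAp : inner2 Ap Ap = 1)
    (hA0 : ∀ z : ℂ, A ≠ z • e0) (hA1 : ∀ z : ℂ, A ≠ z • e1) (hAAp : inner2 A Ap = 0) :
    PairwiseSpanning (frame A Ap) := by
  have a0 : A 0 ≠ 0 := fun h => hA1 (A 1) (by ext i; fin_cases i <;> simp [e1, h])
  have a1 : A 1 ≠ 0 := fun h => hA0 (A 0) (by ext i; fin_cases i <;> simp [e0, h])
  have hApA := inner2_symm_zero hAAp
  rw [inner2_apply] at hA hAp hAAp hApA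
  have p0 : Ap 0 ≠ 0 := by
    intro h
    have h1 : Ap 1 = 0 := by simpa [h, a1] using hAAp
    simp [h, h1] at hAp
  have p1 : Ap 1 ≠ 0 := by
    intro h
    have h0 : Ap 0 = 0 := by simpa [h, a0] using hAAp
    simp [h, h0] at hAp
  have sp1 : star (Ap 1) ≠ 0 := star_ne_zero.mpr p1
  have of_coords : ∀ x : V2, x 0 = 0 → x 1 = 0 → x = 0 := by
    intro x h0 h1
    ext i
    fin_cases i
    exacts [h0, h1]
  have orth : ∀ x : V2, inner2 A x = 0 → inner2 Ap x = 0 → x = 0 := by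
    intro x h h'
    rw [inner2_apply] at h h'
    have h'' : A 0 * x 1 - A 1 * x 0 = 0 :=
      mul_left_cancel₀ sp1 (by linear_combination A 0 * h' - x 0 * hApA)
    exact of_coords x (by linear_combination A 0 * h - star (A 1) * h'' - x 0 * hA)
      (by linear_combination A 1 * h + star (A 0) * h'' - x 1 * hA)
  have with_e0 : ∀ v x : V2, v 1 ≠ 0 → inner2 e0 x = 0 → inner2 v x = 0 → x = 0 := by
    intro v x hv h h'
    have h0 : x 0 = 0 := by simpa [inner2_apply, e0] using h
    exact of_coords x h0 (by simpa [inner2_apply, h0, hv] using h')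
  have with_e1 : ∀ v x : V2, v 0 ≠ 0 → inner2 e1 x = 0 → inner2 v x = 0 → x = 0 := by
    intro v x hv h h'
    have h1 : x 1 = 0 := by simpa [inner2_apply, e1] using h
    exact of_coords x (by simpa [inner2_apply, h1, hv] using h') h1
  refine pairwiseSpanning_of_lt fun i j hij x hi hj => ?_
  fin_cases i <;> fin_cases j <;> first
    | exact absurd hij (by decide)
    | exact orth x hi hj
    | exact with_e0 e1 x (by simp [e1]) hi hj
    | exact with_e0 A x a1 hi hj
    | exact with_e0 Ap x p1 hi hj
    | exact with_e1 A x a0 hi hj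
    | exact with_e1 Ap x p0 hi hj

/-- fewer sites than members: no product of nonzero vectors is orthogonal to all members -/
theorem PairwiseSpanning.exists_eq_zero {κ ι : Type*} [Fintype κ] [Fintype ι]
    (hcard : Fintype.card κ < Fintype.card ι) {u : κ → ι → V2}
    (hu : ∀ k, PairwiseSpanning (u k)) (x : κ → V2)
    (h : ∀ j, ∏ k, inner2 (u k j) (x k) = 0) : ∃ k, x k = 0 := by
  have h' : ∀ j, ∃ k, inner2 (u k j) (x k) = 0 := fun j => by
    simpa [Finset.prod_eq_zero_iff] using h j
  choose f hf using h'
  obtain ⟨i, j, hij, hfij⟩ := Fintype.exists_ne_map_eq_of_card_lt f hcard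
  exact ⟨f i, hu (f i) i j hij _ (hf i) (hfij ▸ hf j)⟩

/-- for unit vectors A, B, C not proportional to |0⟩ or |1⟩, and unit
vectors A⊥, B⊥, C⊥ orthogonal to them, the four vectors |000⟩, |1⟩|B⟩|C⟩,
|A⟩|1⟩|C⊥⟩, |A⊥⟩|B⊥⟩|1⟩ are mutually orthonormal and their span's orthogonal
complement contains no nonzero product vector. -/
theorem stmt3 (A B C Ap Bp Cp : V2)
    (hA : inner2 A A = 1) (hB : inner2 B B = 1) (hC : inner2 C C = 1)
    (hAp : inner2 Ap Ap = 1) (hBp : inner2 Bp Bp = 1) (hCp : inner2 Cp Cp = 1)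
    (hA0 : ∀ z : ℂ, A ≠ z • e0) (hA1 : ∀ z : ℂ, A ≠ z • e1)
    (hB0 : ∀ z : ℂ, B ≠ z • e0) (hB1 : ∀ z : ℂ, B ≠ z • e1)
    (hC0 : ∀ z : ℂ, C ≠ z • e0) (hC1 : ∀ z : ℂ, C ≠ z • e1)
    (hAAp : inner2 A Ap = 0) (hBBp : inner2 B Bp = 0) (hCCp : inner2 C Cp = 0) :
    ∀ Sv : Fin 4 → V8,
      Sv = ![tp3 e0 e0 e0, tp3 e1 B C, tp3 A e1 Cp, tp3 Ap Bp e1] →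
      (∀ i j, inner8 (Sv i) (Sv j) = if i = j then 1 else 0) ∧
      (∀ a b c : V2, (∀ j, inner8 (Sv j) (tp3 a b c) = 0) → tp3 a b c = 0) := by
  rintro _ rfl
  have h00 : inner2 e0 e0 = 1 := by simp [inner2_apply, e0]
  have h11 : inner2 e1 e1 = 1 := by simp [inner2_apply, e1]
  have h01 : inner2 e0 e1 = 0 := by simp [inner2_apply, e0, e1]
  refine ⟨fun i j => ?_, fun a b c h => ?_⟩
  · fin_cases i <;> fin_cases j <;>
      simp [inner8_tp3, h00, h11, h01, inner2_symm_zero h01, hA, hB, hC, hAp, hBp, hCp,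
        hAAp, hBBp, hCCp, inner2_symm_zero hAAp, inner2_symm_zero hBBp, inner2_symm_zero hCCp]
  · have hu : ∀ k, PairwiseSpanning
        (![frame A Ap, frame B Bp ∘ ![0, 2, 1, 3], frame C Cp ∘ ![0, 2, 3, 1]] k) := by
      intro k
      fin_cases k
      · exact pairwiseSpanning_frame hA hAp hA0 hA1 hAAp
      · exact (pairwiseSpanning_frame hB hBp hB0 hB1 hBBp).comp (by decide)
      · exact (pairwiseSpanning_frame hC hCp hC0 hC1 hCCp).comp (by decide)
    obtain ⟨k, hk⟩ := PairwiseSpanning.exists_eq_zero (by simp) hu ![a, b, c] fun j => by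
      have hj := h j
      rw [Fin.prod_univ_three]
      fin_cases j <;> exact (inner8_tp3 ..).symm.trans hj
    ext p
    fin_cases k <;> simp_all [tp3]
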